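/- For any finite simple directed graph G with n vertices and m edges, and any ordering p = p_1, p_2, …, p_n of the vertices of G (i.e., a bijection from {1,…,n} to V(G)), the neighbor score satisfies NScore(G,p) = Σ_{i=1}^{n-1} |N(p_i) ∩ N(p_{i+1})| ≤ m. In particular, the optimal ordering p* maximizing NScore satisfies NScore(G,p*) ≤ m. -/

import Mathlib

/-- Out-neighborhood of `v` in the directed graph with edge set `E`. -/
def Nout {V : Type*} [Fintype V] [DecidableEq V] (E : Finset (V × V)) (v : V) : Finset V :=
  Finset.univ.filter (fun u => (v, u) ∈ E)

/-- Neighbor score of an ordering `p : Fin n → V` of the vertices: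
`NScore(G,p) = Σ_{i=1}^{n-1} |N(p_i) ∩ N(p_{i+1})|`. -/
def NScoreF {V : Type*} [Fintype V] [DecidableEq V] (E : Finset (V × V)) {n : ℕ}
    (p : Fin n → V) : ℕ :=
  ∑ i : Fin (n - 1),
    (Nout E (p ⟨i.1, by have := i.2; omega⟩) ∩ Nout E (p ⟨i.1 + 1, by have := i.2; omega⟩)).card

/-- The out-degrees of a directed graph sum to its number of edges. -/
theorem sum_card_Nout {V : Type*} [Fintype V] [DecidableEq V] (E : Finset (V × V)) :
    ∑ v, (Nout E v).card = E.card := by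
  rw [Finset.card_eq_sum_card_fiberwise (f := Prod.fst) (t := Finset.univ) (by simp)]
  refine Finset.sum_congr rfl fun v _ => ?_
  refine Finset.card_bij (fun u _ => (v, u)) ?_ ?_ ?_
  · simp [Nout]
  · simp
  · rintro ⟨a, b⟩ h
    simp only [Finset.mem_filter] at h
    obtain ⟨h, rfl⟩ := h
    exact ⟨b, by simpa [Nout] using h, rfl⟩

/-- For any finite simple directed graph `G` with `n` vertices and `m` edges and any ordering
`p` of its vertices, `NScore(G,p) ≤ m`. In particular this holds for the optimal ordering. -/
theorem nscore_le_card_edges {V : Type*} [Fintype V] [DecidableEq V]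
    (n m : ℕ) (hn : Fintype.card V = n)
    (E : Finset (V × V)) (hsimple : ∀ e ∈ E, e.1 ≠ e.2) (hm : E.card = m)
    (p : Fin n → V) (hp : Function.Bijective p) :
    NScoreF E p ≤ m := by
  subst hm
  rw [← sum_card_Nout E, NScoreF, ← hp.sum_comp (fun v => (Nout E v).card)]
  have hle : n - 1 ≤ n := Nat.sub_le n 1
  calc _ ≤ ∑ i : Fin (n - 1), (Nout E (p (Fin.castLE hle i))).card :=
        Finset.sum_le_sum fun i _ => Finset.card_le_card Finset.inter_subset_left
    _ = ∑ j ∈ Finset.univ.map (Fin.castLEEmb hle), (Nout E (p j)).card := by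
        simp [Finset.sum_map]
    _ ≤ ∑ j, (Nout E (p j)).card :=
        Finset.sum_le_sum_of_subset (Finset.subset_univ _)
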